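/- arXiv:1505.00995 — 2 statements merged into one kernel-verified Lean document; each statement's English description precedes it below -/
import Mathlib

section
/- Let u : ℝ³ → ℝ³ be of class C³ and let α₁, α₂ ∈ ℝ. Define Mindlin's second-order couple stress tensor field m̃ by m̃ = ((α₁+α₂)/2)·∇curl u + ((α₁−α₂)/2)·(∇curl u)ᵀ, i.e. m̃_{il} = ((α₁+α₂)/2)·Σ_{j,k} ε_{ijk} ∂_l∂_j u_k + ((α₁−α₂)/2)·Σ_{j,k} ε_{ljk} ∂_i∂_j u_k. Then for all i, j and all points of ℝ³: −(1/2)·Σ_{p,m} ε_{ijp} ∂_m m̃_{pm} = ((α₁+α₂)/4)·Δ(∂_j u_i − ∂_i u_j); equivalently, (1/2)·anti(Div m̃) = ((α₁+α₂)/2)·Δ(skw ∇u). -/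
noncomputable section

open scoped BigOperators

/-- Vectors in ℝ³. -/
abbrev V3 : Type := Fin 3 → ℝ

/-- 3×3 real matrices. -/
abbrev M3 : Type := Matrix (Fin 3) (Fin 3) ℝ

/-- The Levi-Civita symbol on `Fin 3`. -/
def eps (i j k : Fin 3) : ℝ :=
  if (i = 0 ∧ j = 1 ∧ k = 2) ∨ (i = 1 ∧ j = 2 ∧ k = 0) ∨ (i = 2 ∧ j = 0 ∧ k = 1) then 1
  else if (i = 0 ∧ j = 2 ∧ k = 1) ∨ (i = 2 ∧ j = 1 ∧ k = 0) ∨ (i = 1 ∧ j = 0 ∧ k = 2) then -1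
  else 0

/-- Euclidean inner product on ℝ³. -/
def dot (a b : V3) : ℝ := ∑ i, a i * b i

/-- Cross product on ℝ³: `(a × b)_i = Σ_{j,k} ε_{ijk} a_j b_k`. -/
def cross (a b : V3) : V3 := fun i => ∑ j, ∑ k, eps i j k * a j * b k

/-- Dyadic product `(a ⊗ b)_{ij} = a_i b_j`. -/
def tensor (a b : V3) : M3 := Matrix.of fun i j => a i * b j

/-- Symmetric part `sym X = (X + Xᵀ)/2`. -/
def symPart (X : M3) : M3 := (1 / 2 : ℝ) • (X + X.transpose)

/-- Skew-symmetric part `skw X = (X − Xᵀ)/2`. -/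
def skwPart (X : M3) : M3 := (1 / 2 : ℝ) • (X - X.transpose)

/-- Deviatoric part `dev X = X − (tr X / 3)·𝟙`. -/
def devPart (X : M3) : M3 := X - ((Matrix.trace X) / 3) • (1 : M3)

/-- Axial vector: `axl(X)_k = −(1/2) Σ_{i,j} ε_{ijk} X_{ij}`. -/
def axl (X : M3) : V3 := fun k => -(1 / 2 : ℝ) * ∑ i, ∑ j, eps i j k * X i j

/-- `anti(v)_{ij} = −Σ_k ε_{ijk} v_k`, so that `anti(v)·w = v × w`. -/
def antiV (v : V3) : M3 := Matrix.of fun i j => -(∑ k, eps i j k * v k)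

/-- Squared Frobenius norm `‖X‖² = Σ_{ij} X_{ij}²`. -/
def normSq (X : M3) : ℝ := ∑ i, ∑ j, (X i j) ^ 2

/-- `k`-th standard basis vector of ℝ³. -/
def ee (k : Fin 3) : V3 := Pi.single k 1

/-- Partial derivative `∂_k f` of a scalar field. -/
def pd (f : V3 → ℝ) (k : Fin 3) (x : V3) : ℝ := fderiv ℝ f x (ee k)

/-- Gradient of a scalar field. -/
def grad (f : V3 → ℝ) (x : V3) : V3 := fun k => pd f k x

/-- Partial derivative `∂_k u_i` of a vector field. -/
def pdV (u : V3 → V3) (i k : Fin 3) (x : V3) : ℝ := pd (fun y => u y i) k x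

/-- Gradient matrix `(∇u)_{ij} = ∂_j u_i`. -/
def gradV (u : V3 → V3) (x : V3) : M3 := Matrix.of fun i j => pdV u i j x

/-- Divergence `div u = Σ_p ∂_p u_p`. -/
def divV (u : V3 → V3) (x : V3) : ℝ := ∑ p, pdV u p p x

/-- Curl: `(curl u)_i = Σ_{j,k} ε_{ijk} ∂_j u_k`. -/
def curl (u : V3 → V3) (x : V3) : V3 := fun i => ∑ j, ∑ k, eps i j k * pdV u k j x

/-- Second partial derivative `∂_k ∂_j u_i` of a vector field. -/
def pd2V (u : V3 → V3) (i j k : Fin 3) (x : V3) : ℝ := pd (fun y => pdV u i j y) k x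

/-- Scalar Laplacian `Δf = Σ_m ∂_m ∂_m f`. -/
def lap (f : V3 → ℝ) (x : V3) : ℝ := ∑ m, pd (fun y => pd f m y) m x

/-- Mindlin's second order couple stress tensor:
`m̃_{il} = ((α₁+α₂)/2)·Σ_{j,k} ε_{ijk} ∂_l∂_j u_k + ((α₁−α₂)/2)·Σ_{j,k} ε_{ljk} ∂_i∂_j u_k`. -/
def mindlin (α₁ α₂ : ℝ) (u : V3 → V3) (i l : Fin 3) (x : V3) : ℝ :=
  ((α₁ + α₂) / 2) * ∑ j, ∑ k, eps i j k * pd2V u k j l x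
  + ((α₁ - α₂) / 2) * ∑ j, ∑ k, eps l j k * pd2V u k j i x

theorem ContDiff.pd {f : V3 → ℝ} {n m : WithTop ℕ∞} (hf : ContDiff ℝ n f) (h : m + 1 ≤ n)
    (k : Fin 3) : ContDiff ℝ m (fun y => pd f k y) :=
  (hf.fderiv_right h).clm_apply contDiff_const

theorem pd_add {f g : V3 → ℝ} (hf : Differentiable ℝ f) (hg : Differentiable ℝ g)
    (k : Fin 3) (x : V3) : pd (fun y => f y + g y) k x = pd f k x + pd g k x := by
  simp [pd, fderiv_fun_add (hf x) (hg x)]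

theorem pd_sub {f g : V3 → ℝ} (hf : Differentiable ℝ f) (hg : Differentiable ℝ g)
    (k : Fin 3) (x : V3) : pd (fun y => f y - g y) k x = pd f k x - pd g k x := by
  simp [pd, fderiv_fun_sub (hf x) (hg x)]

theorem pd_const_mul {f : V3 → ℝ} (hf : Differentiable ℝ f) (c : ℝ)
    (k : Fin 3) (x : V3) : pd (fun y => c * f y) k x = c * pd f k x := by
  simp [pd, fderiv_const_mul (hf x) c]

theorem pd_sum {ι : Type*} {s : Finset ι} {f : ι → V3 → ℝ} (hf : ∀ i, Differentiable ℝ (f i))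
    (k : Fin 3) (x : V3) : pd (fun y => ∑ i ∈ s, f i y) k x = ∑ i ∈ s, pd (f i) k x := by
  simp [pd, fderiv_fun_sum (fun i _ => hf i x)]

/-- Schwarz's theorem: partial derivatives of a `C²` scalar field commute. -/
theorem pd_comm {f : V3 → ℝ} (hf : ContDiff ℝ 2 f) (j k : Fin 3) (x : V3) :
    pd (fun y => pd f j y) k x = pd (fun y => pd f k y) j x := by
  have hd : DifferentiableAt ℝ (fderiv ℝ f) x :=
    (hf.fderiv_right (m := 1) (by norm_num)).differentiable (by norm_num) x
  have hs : IsSymmSndFDerivAt ℝ f x := hf.contDiffAt.isSymmSndFDerivAt (by simp)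
  have key (a b : Fin 3) :
      pd (fun y => pd f a y) b x = fderiv ℝ (fderiv ℝ f) x (ee b) (ee a) := by
    simp only [pd]
    rw [fderiv_clm_apply hd (differentiableAt_const _)]
    simp
  rw [key, key]
  exact hs _ _

/-- Partial derivative of the Mindlin couple stress in terms of third derivatives of `u`. -/
theorem pd_mindlin (α₁ α₂ : ℝ) {u : V3 → V3} (hu : ContDiff ℝ 3 u) (i l m : Fin 3) (x : V3) :
    pd (fun y => mindlin α₁ α₂ u i l y) m x
      = ((α₁ + α₂) / 2) * ∑ j, ∑ k, eps i j k * pd (fun y => pd2V u k j l y) m x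
        + ((α₁ - α₂) / 2) * ∑ j, ∑ k, eps l j k * pd (fun y => pd2V u k j i y) m x := by
  have h2 (k a b : Fin 3) : Differentiable ℝ (fun y => pd2V u k a b y) :=
    ((((contDiff_pi.1 hu k).pd (m := 2) (by norm_num) a).pd (m := 1) (by norm_num) b)).differentiable
      (by norm_num)
  have hk (a b j k : Fin 3) : Differentiable ℝ (fun y => eps a j k * pd2V u k j b y) :=
    (h2 k j b).const_mul _
  have hj (a b j : Fin 3) : Differentiable ℝ (fun y => ∑ k, eps a j k * pd2V u k j b y) :=
    Differentiable.fun_sum fun k _ => hk a b j k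
  have hs (a b : Fin 3) : Differentiable ℝ (fun y => ∑ j, ∑ k, eps a j k * pd2V u k j b y) :=
    Differentiable.fun_sum fun j _ => hj a b j
  have main (a b : Fin 3) : pd (fun y => ∑ j, ∑ k, eps a j k * pd2V u k j b y) m x
      = ∑ j, ∑ k, eps a j k * pd (fun y => pd2V u k j b y) m x := by
    rw [pd_sum (hj a b)]
    refine Finset.sum_congr rfl fun j _ => ?_
    rw [pd_sum (hk a b j)]
    exact Finset.sum_congr rfl fun k _ => pd_const_mul (h2 k j b) _ _ _
  simp only [mindlin]
  rw [pd_add ((hs i l).const_mul _) ((hs l i).const_mul _), pd_const_mul (hs i l),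
    pd_const_mul (hs l i), main, main]

/-- Laplacian of the skew part of the gradient in terms of third derivatives of `u`. -/
theorem lap_pdV_sub {u : V3 → V3} (hu : ContDiff ℝ 3 u) (i j : Fin 3) (x : V3) :
    lap (fun y => pdV u i j y - pdV u j i y) x
      = ∑ m, (pd (fun y => pd2V u i j m y) m x - pd (fun y => pd2V u j i m y) m x) := by
  have h1 (k a : Fin 3) : ContDiff ℝ 2 (fun y => pdV u k a y) :=
    (contDiff_pi.1 hu k).pd (by norm_num) a
  have h2 (k a b : Fin 3) : Differentiable ℝ (fun y => pd2V u k a b y) :=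
    ((h1 k a).pd (m := 1) (by norm_num) b).differentiable (by norm_num)
  refine Finset.sum_congr rfl fun m _ => ?_
  rw [← pd_sub (h2 i j m) (h2 j i m)]
  congr 1
  funext y
  exact pd_sub ((h1 i j).differentiable (by norm_num)) ((h1 j i).differentiable (by norm_num)) m y

/-- `−(1/2)·Σ_{p,m} ε_{ijp} ∂_m m̃_{pm} = ((α₁+α₂)/4)·Δ(∂_j u_i − ∂_i u_j)`,
i.e. `(1/2)·anti(Div m̃) = ((α₁+α₂)/2)·Δ(skw ∇u)`. -/
theorem statement4 (α₁ α₂ : ℝ) (u : V3 → V3) (hu : ContDiff ℝ 3 u) :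
    ∀ (i j : Fin 3) (x : V3),
      -(1 / 2 : ℝ) * ∑ p, ∑ m, eps i j p * pd (fun y => mindlin α₁ α₂ u p m y) m x
        = ((α₁ + α₂) / 4) * lap (fun y => pdV u i j y - pdV u j i y) x := by
  intro i j x
  have h0 (k : Fin 3) : ContDiff ℝ 3 (fun y => u y k) := contDiff_pi.1 hu k
  have h1 (k a : Fin 3) : ContDiff ℝ 2 (fun y => pdV u k a y) := (h0 k).pd (by norm_num) a
  simp only [pd_mindlin α₁ α₂ hu, lap_pdV_sub hu]
  have hswap (k a b c : Fin 3) :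
      pd (fun y => pd2V u k a b y) c x = pd (fun y => pd2V u k b a y) c x := by
    congr 1
    funext y
    exact pd_comm ((h0 k).of_le (by norm_num)) a b y
  have hswap' (k a b c : Fin 3) :
      pd (fun y => pd2V u k a b y) c x = pd (fun y => pd2V u k a c y) b x :=
    pd_comm (h1 k a) b c x
  generalize hD : (fun k a b c => pd (fun y => pd2V u k a b y) c x) = D
  replace hD (k a b c : Fin 3) : pd (fun y => pd2V u k a b y) c x = D k a b c := by rw [← hD]
  simp only [hD] at hswap hswap' ⊢
  have e1 (k c : Fin 3) : D k 1 0 c = D k 0 1 c := hswap k 1 0 c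
  have e2 (k c : Fin 3) : D k 2 0 c = D k 0 2 c := hswap k 2 0 c
  have e3 (k c : Fin 3) : D k 2 1 c = D k 1 2 c := hswap k 2 1 c
  have f1 (k a : Fin 3) : D k a 1 0 = D k a 0 1 := hswap' k a 1 0
  have f2 (k a : Fin 3) : D k a 2 0 = D k a 0 2 := hswap' k a 2 0
  have f3 (k a : Fin 3) : D k a 2 1 = D k a 1 2 := hswap' k a 2 1
  fin_cases i <;> fin_cases j <;>
    simp [Fin.sum_univ_three, eps, e1, e2, e3, f1, f2, f3] <;> ring
end
end

section
/- Let u : ℝ³ → ℝ³ be of class C². Then the gradient of the axial vector of the skew part of ∇u equals the transpose of the row-wise Curl of the symmetric part of ∇u: for all k, l and all points of ℝ³, ∂_l (axl(skw ∇u))_k = Σ_{a,b} ε_{kab} ∂_a (sym ∇u)_{lb}; in compact form, ∇[axl(skw ∇u)] = [Curl(sym ∇u)]ᵀ. -/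
noncomputable section

open scoped BigOperators

/-- `axl(skw X) = (1/2) Σ_{i,j} ε_{kij} X_{ji}`. -/
theorem axl_skwPart_apply (X : M3) (k : Fin 3) :
    axl (skwPart X) k = (1 / 2 : ℝ) * ∑ i, ∑ j, eps k i j * X j i := by
  fin_cases k <;> simp [axl, skwPart, Fin.sum_univ_three, eps] <;> ring

theorem contDiff_pdV {u : V3 → V3} (hu : ContDiff ℝ 2 u) (i j : Fin 3) :
    ContDiff ℝ 1 (pdV u i j) :=
  ((contDiff_pi.1 hu i).fderiv_right (m := 1) (by norm_num)).clm_apply contDiff_const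

theorem differentiable_pdV {u : V3 → V3} (hu : ContDiff ℝ 2 u) (i j : Fin 3) :
    Differentiable ℝ (pdV u i j) :=
  (contDiff_pdV hu i j).differentiable one_ne_zero

theorem pd2V_eq_fderiv_fderiv {u : V3 → V3} (hu : ContDiff ℝ 2 u) (i j k : Fin 3) (x : V3) :
    pd2V u i j k x = fderiv ℝ (fderiv ℝ fun y => u y i) x (ee k) (ee j) := by
  have h : DifferentiableAt ℝ (fderiv ℝ fun y => u y i) x :=
    (((contDiff_pi.1 hu i).fderiv_right (m := 1) (by norm_num)).differentiable one_ne_zero) x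
  simp only [pd2V, pdV, pd]
  rw [fderiv_clm_apply h (differentiableAt_const _)]
  simp

/-- Mixed second partial derivatives of a `C²` vector field commute. -/
theorem pd2V_comm {u : V3 → V3} (hu : ContDiff ℝ 2 u) (i j k : Fin 3) (x : V3) :
    pd2V u i j k x = pd2V u i k j x := by
  rw [pd2V_eq_fderiv_fderiv hu, pd2V_eq_fderiv_fderiv hu]
  exact (contDiff_pi.1 hu i).contDiffAt.isSymmSndFDerivAt (by simp) _ _

theorem pd_axl_skwPart_gradV {u : V3 → V3} (hu : ContDiff ℝ 2 u) (k l : Fin 3) (x : V3) :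
    pd (fun y => axl (skwPart (gradV u y)) k) l x =
      (1 / 2 : ℝ) * ∑ a, ∑ b, eps k a b * pd2V u b a l x := by
  have h : ∀ i j, HasFDerivAt (pdV u i j) (fderiv ℝ (pdV u i j) x) x :=
    fun i j => (differentiable_pdV hu i j x).hasFDerivAt
  have hd : HasFDerivAt (fun y => (1 / 2 : ℝ) * ∑ a, ∑ b, eps k a b * pdV u b a y)
      ((1 / 2 : ℝ) • ∑ a, ∑ b, eps k a b • fderiv ℝ (pdV u b a) x) x :=
    (HasFDerivAt.fun_sum fun a _ => HasFDerivAt.fun_sum fun b _ =>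
      (h b a).const_mul (eps k a b)).const_mul _
  simp only [axl_skwPart_apply, gradV, Matrix.of_apply, pd, pd2V]
  rw [hd.fderiv]
  simp

theorem pd_symPart_gradV {u : V3 → V3} (hu : ContDiff ℝ 2 u) (i j a : Fin 3) (x : V3) :
    pd (fun y => symPart (gradV u y) i j) a x =
      (1 / 2 : ℝ) * (pd2V u i j a x + pd2V u j i a x) := by
  have hd := ((differentiable_pdV hu i j x).hasFDerivAt.fun_add
    (differentiable_pdV hu j i x).hasFDerivAt).const_mul (1 / 2 : ℝ)
  simp only [symPart, gradV, Matrix.smul_apply, Matrix.add_apply, Matrix.transpose_apply,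
    Matrix.of_apply, smul_eq_mul, pd, pd2V]
  rw [hd.fderiv]
  rfl

/-- The contraction of the Levi-Civita symbol with a symmetric matrix vanishes. -/
theorem sum_eps_mul_eq_zero_of_symm (k : Fin 3) (S : Fin 3 → Fin 3 → ℝ)
    (hS : ∀ a b, S a b = S b a) : ∑ a, ∑ b, eps k a b * S a b = 0 := by
  fin_cases k <;> simp [Fin.sum_univ_three, eps, hS 1 0, hS 2 0, hS 2 1]

/-- `∇[axl(skw ∇u)] = [Curl(sym ∇u)]ᵀ`, componentwise:
`∂_l (axl(skw ∇u))_k = Σ_{a,b} ε_{kab} ∂_a (sym ∇u)_{lb}`. -/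
theorem statement7 (u : V3 → V3) (hu : ContDiff ℝ 2 u) :
    ∀ (k l : Fin 3) (x : V3),
      pd (fun y => axl (skwPart (gradV u y)) k) l x
        = ∑ a, ∑ b, eps k a b * pd (fun y => symPart (gradV u y) l b) a x := by
  intro k l x
  simp only [pd_axl_skwPart_gradV hu, pd_symPart_gradV hu]
  have h0 := sum_eps_mul_eq_zero_of_symm k (fun a b => pd2V u l b a x)
    fun a b => pd2V_comm hu l b a x
  calc (1 / 2 : ℝ) * ∑ a, ∑ b, eps k a b * pd2V u b a l x
      = (1 / 2 : ℝ) * (∑ a, ∑ b, eps k a b * pd2V u l b a x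
          + ∑ a, ∑ b, eps k a b * pd2V u b l a x) := by
        rw [h0, zero_add]
        simp only [fun a b => pd2V_comm hu b a l x]
    _ = ∑ a, ∑ b, eps k a b * ((1 / 2 : ℝ) * (pd2V u l b a x + pd2V u b l a x)) := by
        simp only [← Finset.sum_add_distrib, Finset.mul_sum]
        exact Finset.sum_congr rfl fun a _ => Finset.sum_congr rfl fun b _ => by ring
end
end
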